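/- arXiv:0712.3213 — 2 statements merged into one kernel-verified Lean document; each statement's English description precedes it below -/
import Mathlib

section
/- Let n ≥ 0 and let C_j denote the j-th Catalan number. The number of lattice paths from (0,0) with terminus (2n+1, 2n+1) that lie weakly under the boundary word U(R²U²)ⁿR equals 2·C_{2n+1}. -/
/-- A lattice path is a list of steps: `false` = R-step `(1,0)`, `true` = U-step `(0,1)`,
starting at the origin.  `UnderWord B P` says `P` lies weakly under the boundary word `B`:
for each `y`, the number of R-steps of `P` preceding its `y`-th U-step is at least the
number of R-steps of `B` preceding the `y`-th U-step of `B` (expressed via the prefixes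
ending just before those U-steps). -/
def UnderWord (B P : List Bool) : Prop :=
  ∀ pB rB pP rP : List Bool, B = pB ++ true :: rB → P = pP ++ true :: rP →
    pP.count true = pB.count true → pB.count false ≤ pP.count false

/-- The boundary word `U(R²U²)ⁿR`. -/
def bdryURRUUnR (n : ℕ) : List Bool :=
  [true] ++ (List.replicate n [false, false, true, true]).flatten ++ [false]

theorem underWord_concat_false (B P : List Bool) :
    UnderWord B (P ++ [false]) ↔ UnderWord B P := by
  refine ⟨fun h pB rB pP rP hB hP => h pB rB pP (rP ++ [false]) hB (by simp [hP]),
    fun h pB rB pP rP hB hP => ?_⟩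
  rcases List.eq_nil_or_concat rP with rfl | ⟨r, x, rfl⟩
  · simpa using (List.append_inj' hP rfl).2
  · refine h pB rB pP r hB ?_
    have hP' : P ++ [false] = (pP ++ true :: r) ++ [x] := by simpa using hP
    exact (List.append_inj' hP' rfl).1

theorem underWord_concat_true (B P : List Bool) :
    UnderWord B (P ++ [true]) ↔ UnderWord B P ∧ ∀ pB rB, B = pB ++ true :: rB →
      P.count true = pB.count true → pB.count false ≤ P.count false := by
  refine ⟨fun h => ⟨fun pB rB pP rP hB hP => h pB rB pP (rP ++ [true]) hB (by simp [hP]),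
    fun pB rB hB => h pB rB P [] hB rfl⟩, fun ⟨h, h'⟩ pB rB pP rP hB hP => ?_⟩
  rcases List.eq_nil_or_concat rP with rfl | ⟨r, x, rfl⟩
  · obtain rfl := (List.append_inj' hP rfl).1
    exact h' pB rB hB
  · refine h pB rB pP r hB ?_
    have hP' : P ++ [true] = (pP ++ true :: r) ++ [x] := by simpa using hP
    exact (List.append_inj' hP' rfl).1

theorem bdryURRUUnR_succ (n : ℕ) :
    bdryURRUUnR (n + 1) = true :: false :: false :: true :: bdryURRUUnR n := by
  simp [bdryURRUUnR, List.replicate_succ]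

theorem count_false_of_bdryURRUUnR_eq {n : ℕ} {p r : List Bool}
    (h : bdryURRUUnR n = p ++ true :: r) : p.count false = 2 * ((p.count true + 1) / 2) := by
  induction n generalizing p with
  | zero =>
    rcases p with _ | ⟨a, _ | ⟨b, p⟩⟩ <;> simp_all [bdryURRUUnR]
  | succ n ih =>
    rw [bdryURRUUnR_succ] at h
    rcases p with _ | ⟨a, _ | ⟨b, _ | ⟨c, _ | ⟨d, p⟩⟩⟩⟩
    · simp
    · simp at h
    · simp at h
    · simp at h
      obtain ⟨rfl, rfl, rfl, -⟩ := h
      simp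
    · simp only [List.cons_append, List.cons.injEq] at h
      obtain ⟨rfl, rfl, rfl, rfl, h⟩ := h
      have := ih h
      simp only [List.count_cons, beq_self_eq_true, if_true]
      simp
      omega

theorem exists_bdryURRUUnR_eq {n u : ℕ} (hu : u ≤ 2 * n) :
    ∃ p r, bdryURRUUnR n = p ++ true :: r ∧ p.count true = u := by
  induction n generalizing u with
  | zero => exact ⟨[], [false], rfl, by simp; omega⟩
  | succ n ih =>
    rw [bdryURRUUnR_succ]
    match u with
    | 0 => exact ⟨[], _, rfl, rfl⟩
    | 1 => exact ⟨[true, false, false], _, rfl, rfl⟩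
    | u + 2 =>
      obtain ⟨p, r, h, hp⟩ := ih (u := u) (by omega)
      exact ⟨true :: false :: false :: true :: p, r, by simp [h], by simp [hp]⟩

/-- The paths with terminus `(k, l)` weakly under `U(R²U²)ⁿR`. -/
def pathsUnder (n k l : ℕ) : Set (List Bool) :=
  {P | P.count false = k ∧ P.count true = l ∧ UnderWord (bdryURRUUnR n) P}

theorem pathsUnder_finite (n k l : ℕ) : (pathsUnder n k l).Finite := by
  refine (List.finite_length_eq Bool (k + l)).subset ?_
  rintro P ⟨rfl, rfl, -⟩
  exact (List.count_false_add_count_true P).symm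

theorem concat_false_mem_pathsUnder {n k l : ℕ} {P : List Bool} :
    P ++ [false] ∈ pathsUnder n (k + 1) l ↔ P ∈ pathsUnder n k l := by
  simp [pathsUnder, underWord_concat_false]

theorem concat_true_mem_pathsUnder {n k l : ℕ} (hl : l ≤ 2 * n) {P : List Bool} :
    P ++ [true] ∈ pathsUnder n k (l + 1) ↔
      P ∈ pathsUnder n k l ∧ 2 * ((l + 1) / 2) ≤ k := by
  simp only [pathsUnder, Set.mem_ofPred_eq, underWord_concat_true, List.count_append]
  simp only [List.count_singleton, beq_self_eq_true, if_true, Nat.add_right_cancel_iff]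
  simp only [Bool.beq_eq_decide_eq, Bool.true_eq_false, decide_false, Bool.false_eq_true,
    if_false, add_zero]
  constructor
  · rintro ⟨rfl, rfl, h, h'⟩
    obtain ⟨p, r, hp, hc⟩ := exists_bdryURRUUnR_eq hl
    refine ⟨⟨rfl, rfl, h⟩, ?_⟩
    rw [← hc, ← count_false_of_bdryURRUUnR_eq hp]
    exact h' p r hp hc.symm
  · rintro ⟨⟨rfl, rfl, h⟩, h'⟩
    refine ⟨rfl, rfl, h, fun p r hp hc => ?_⟩
    rwa [count_false_of_bdryURRUUnR_eq hp, ← hc]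

theorem pathsUnder_zero_zero (n : ℕ) : pathsUnder n 0 0 = {[]} := by
  ext P
  rcases P with _ | ⟨_ | _, P⟩ <;> simp [pathsUnder, UnderWord]

theorem pathsUnder_succ_zero (n k : ℕ) :
    pathsUnder n (k + 1) 0 = (· ++ [false]) '' pathsUnder n k 0 := by
  ext P
  rcases List.eq_nil_or_concat P with rfl | ⟨P, _ | _, rfl⟩
  · simp [pathsUnder]
  · simp [concat_false_mem_pathsUnder]
  · simp [pathsUnder]

theorem pathsUnder_zero_succ {n l : ℕ} (hl : l ≤ 2 * n) :
    pathsUnder n 0 (l + 1) =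
      (· ++ [true]) '' {P ∈ pathsUnder n 0 l | 2 * ((l + 1) / 2) ≤ 0} := by
  ext P
  rcases List.eq_nil_or_concat P with rfl | ⟨P, _ | _, rfl⟩
  · simp [pathsUnder]
  · simp [pathsUnder]
  · simp [concat_true_mem_pathsUnder hl]

theorem pathsUnder_succ_succ {n l : ℕ} (hl : l ≤ 2 * n) (k : ℕ) :
    pathsUnder n (k + 1) (l + 1) = (· ++ [false]) '' pathsUnder n k (l + 1) ∪
      (· ++ [true]) '' {P ∈ pathsUnder n (k + 1) l | 2 * ((l + 1) / 2) ≤ k + 1} := by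
  ext P
  rcases List.eq_nil_or_concat P with rfl | ⟨P, _ | _, rfl⟩
  · simp [pathsUnder]
  · simp [concat_false_mem_pathsUnder]
  · simp [concat_true_mem_pathsUnder hl]

theorem ncard_concat_image (x : Bool) (s : Set (List Bool)) :
    ((· ++ [x]) '' s).ncard = s.ncard :=
  Set.ncard_image_of_injective s (List.append_left_injective [x])

theorem ncard_sep_const (s : Set (List Bool)) (p : Prop) [Decidable p] :
    {P ∈ s | p}.ncard = if p then s.ncard else 0 := by
  split_ifs with h <;> simp [h]

theorem ncard_pathsUnder_zero (n k : ℕ) : (pathsUnder n k 0).ncard = 1 := by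
  induction k with
  | zero => simp [pathsUnder_zero_zero]
  | succ k ih => rw [pathsUnder_succ_zero, ncard_concat_image, ih]

theorem ncard_pathsUnder_zero_succ {n l : ℕ} (hl : l ≤ 2 * n) :
    (pathsUnder n 0 (l + 1)).ncard =
      if 2 * ((l + 1) / 2) ≤ 0 then (pathsUnder n 0 l).ncard else 0 := by
  rw [pathsUnder_zero_succ hl, ncard_concat_image, ncard_sep_const]

theorem ncard_pathsUnder_succ_succ {n l : ℕ} (hl : l ≤ 2 * n) (k : ℕ) :
    (pathsUnder n (k + 1) (l + 1)).ncard = (pathsUnder n k (l + 1)).ncard +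
      if 2 * ((l + 1) / 2) ≤ k + 1 then (pathsUnder n (k + 1) l).ncard else 0 := by
  rw [pathsUnder_succ_succ hl, Set.ncard_union_eq ?_ ?_ ?_, ncard_concat_image,
    ncard_concat_image, ncard_sep_const]
  · rw [Set.disjoint_left]
    rintro _ ⟨P, -, rfl⟩ ⟨Q, -, h⟩
    simpa using (List.append_inj' h rfl).2
  · exact (pathsUnder_finite _ _ _).image _
  · exact ((pathsUnder_finite _ _ _).subset (Set.sep_subset _ _)).image _

theorem ncard_pathsUnder_eq_zero {n k l : ℕ} (hl : l ≤ 2 * n) (hkl : k < l) :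
    (pathsUnder n k (l + 1)).ncard = 0 := by
  induction k with
  | zero => rw [ncard_pathsUnder_zero_succ hl, if_neg (by omega)]
  | succ k ih => rw [ncard_pathsUnder_succ_succ hl, ih (by omega), if_neg (by omega)]

/-- The number of paths with terminus `(l + d, l)` under the infinite boundary `U(R²U²)^∞`. -/
def underCount : ℕ → ℕ → ℕ
  | _, 0 => 1
  | 0, l + 1 => underCount 1 l + if Even l then underCount 0 l else 0
  | d + 1, l + 1 => underCount d (l + 1) + underCount (d + 2) l
termination_by d l => (l, d)

theorem ncard_pathsUnder_diag_succ {n l : ℕ} (hl : l ≤ 2 * n) :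
    (pathsUnder n l (l + 1)).ncard = if Even l then (pathsUnder n l l).ncard else 0 := by
  cases l with
  | zero => simp [ncard_pathsUnder_zero_succ hl]
  | succ m =>
    rw [ncard_pathsUnder_succ_succ hl, ncard_pathsUnder_eq_zero hl (by omega), zero_add]
    refine if_congr ?_ rfl rfl
    rw [Nat.even_iff]
    omega

theorem ncard_pathsUnder_add {n l : ℕ} (hl : l ≤ 2 * n + 1) (d : ℕ) :
    (pathsUnder n (l + d) l).ncard = underCount d l := by
  induction l generalizing d with
  | zero => rw [ncard_pathsUnder_zero, underCount]
  | succ l ih =>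
    have hl' : l ≤ 2 * n := by omega
    have ih' := ih (by omega)
    induction d with
    | zero =>
      rw [add_zero, ncard_pathsUnder_succ_succ hl', if_pos (by omega), underCount, ← ih' 1,
        ← ih' 0, ncard_pathsUnder_diag_succ hl', add_comm, add_zero]
    | succ d ihd =>
      rw [← add_assoc, ncard_pathsUnder_succ_succ hl', if_pos (by omega), underCount, ihd,
        ← ih' (d + 2)]
      congr 3
      omega

open PowerSeries in
theorem map_catalanSeries_eq (R : Type*) [CommRing R] :
    catalanSeries.map (Nat.castRingHom R) =
      1 + X * catalanSeries.map (Nat.castRingHom R) ^ 2 := by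
  conv_lhs => rw [← catalanSeries_sq_mul_X_add_one]
  simp only [map_add, map_mul, map_pow, map_one, map_X]
  ring

open PowerSeries in
theorem underCount_eq_coeff (d l : ℕ) :
    (underCount d l : ℤ) = coeff l ((catalanSeries.map (Nat.castRingHom ℤ)) ^ (d + 1) *
      (1 + X * mk fun i => if Even i then (underCount 0 i : ℤ) else 0)) := by
  set C : ℤ⟦X⟧ := catalanSeries.map (Nat.castRingHom ℤ) with hC
  set W : ℤ⟦X⟧ := mk fun i => if Even i then (underCount 0 i : ℤ) else 0 with hW
  have hCC : C = 1 + X * C ^ 2 := map_catalanSeries_eq ℤ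
  induction l generalizing d with
  | zero =>
    have h0 : constantCoeff C = 1 := by rw [hCC]; simp
    rw [underCount]
    simp [h0]
  | succ l ih =>
    induction d with
    | zero =>
      have h : C ^ (0 + 1) * (1 + X * W) = 1 + X * (W + C ^ (1 + 1) * (1 + X * W)) := by
        linear_combination (1 + X * W) * hCC
      rw [h, map_add, coeff_succ_X_mul, map_add, ← ih, underCount]
      simp [hW, add_comm]
    | succ d ihd =>
      have h : C ^ (d + 1 + 1) * (1 + X * W) =
          C ^ (d + 1) * (1 + X * W) + X * (C ^ (d + 2 + 1) * (1 + X * W)) := by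
        linear_combination C ^ (d + 1) * (1 + X * W) * hCC
      rw [h, map_add, coeff_succ_X_mul, ← ih, ← ihd, underCount]
      simp

open PowerSeries in
theorem underCount_zero_odd (n : ℕ) :
    underCount 0 (2 * n + 1) = 2 * catalan (2 * n + 1) := by
  set C : ℤ⟦X⟧ := catalanSeries.map (Nat.castRingHom ℤ) with hC
  set W : ℤ⟦X⟧ := mk fun i => if Even i then (underCount 0 i : ℤ) else 0 with hW
  have hCC : C = 1 + X * C ^ 2 := map_catalanSeries_eq ℤ
  set A : ℤ⟦X⟧ := mk fun i => (underCount 0 i : ℤ) with hA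
  have hAC : A = C * (1 + X * W) := by
    ext i
    rw [hA, coeff_mk, underCount_eq_coeff, zero_add, pow_one]
  have hX : evalNegHom (X : ℤ⟦X⟧) = -X := evalNegHom_X
  set C' := evalNegHom C with hC'
  have hCC' : C' = 1 - X * C' ^ 2 := by
    have := congrArg evalNegHom hCC
    simp only [map_add, map_mul, map_pow, map_one, hX] at this
    linear_combination this
  have hWn : evalNegHom W = W := by
    ext i
    rw [evalNegHom, coeff_rescale, hW, coeff_mk]
    split_ifs with h <;> simp [h]
  have hA' : evalNegHom A = C' * (1 - X * W) := by
    rw [hAC]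
    simp only [map_add, map_mul, map_one, hX, hWn]
    ring
  have hAW : A + evalNegHom A = 2 * W := by
    ext i
    rw [two_mul, map_add, map_add, evalNegHom, coeff_rescale, hW, hA, coeff_mk, coeff_mk]
    split_ifs with h
    · simp [h]
    · simp [Nat.not_even_iff_odd.mp h]
  have hne : (2 - X * (C - C') : ℤ⟦X⟧) ≠ 0 := by
    intro h
    have := congrArg constantCoeff h
    rw [← one_add_one_eq_two] at this
    simp at this
  have key : X * W * (C + C') = C - C' := by
    refine mul_right_cancel₀ hne ?_
    have hW' : W * (2 - X * (C - C')) = C + C' := by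
      linear_combination -hAW + hAC + hA'
    linear_combination X * (C + C') * hW' - 2 * hCC + 2 * hCC'
  have hsub : A - evalNegHom A = 2 * (C - C') := by
    linear_combination hAC - hA' + key
  have hodd : Odd (2 * n + 1) := ⟨n, rfl⟩
  have := congrArg (coeff (2 * n + 1)) hsub
  rw [two_mul (C - C'), map_sub, map_add, map_sub, hC', evalNegHom, coeff_rescale, coeff_rescale,
    hodd.neg_one_pow, hA, coeff_mk, hC, coeff_map, catalanSeries_coeff] at this
  simp at this
  omega

theorem stmt13 (n : ℕ) :
    Nat.card {P : List Bool //
        P.count false = 2 * n + 1 ∧ P.count true = 2 * n + 1 ∧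
        UnderWord (bdryURRUUnR n) P} =
      2 * catalan (2 * n + 1) := by
  rw [← underCount_zero_odd]
  exact ncard_pathsUnder_add le_rfl 0
end

section
/- Let n ≥ 1 and let C_j denote the j-th Catalan number. The number of lattice paths from (0,0) with terminus (2n−1, 2n) that lie weakly under the boundary word (U²R²)ⁿ equals 2^{2n+1}·C_n − C_{2n+1}. -/
/-- The boundary word `(U²R²)ⁿ`. -/
def bdryUURRn (n : ℕ) : List Bool :=
  (List.replicate n [true, true, false, false]).flatten

theorem sum_range_two_mul {M : Type*} [AddCommMonoid M] (F : ℕ → M) (m : ℕ) :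
    ∑ i ∈ Finset.range (2 * m), F i = ∑ i ∈ Finset.range m, (F (2 * i) + F (2 * i + 1)) := by
  induction m with
  | zero => simp
  | succ m ih => rw [Nat.mul_succ, Finset.sum_range_succ, Finset.sum_range_succ, ih,
      Finset.sum_range_succ, add_assoc]

theorem catalan_succ_eq_sum_range (n : ℕ) :
    catalan (n + 1) = ∑ i ∈ Finset.range (n + 1), catalan i * catalan (n - i) := by
  rw [catalan_succ, Fin.sum_univ_eq_sum_range (fun i => catalan i * catalan (n - i))]

section CatalanSeries

open PowerSeries

/-- The generating function of the Catalan numbers of even index. -/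
noncomputable def evenCatalanSeries : ℤ⟦X⟧ := mk fun k => (catalan (2 * k) : ℤ)

/-- The generating function of the Catalan numbers of odd index. -/
noncomputable def oddCatalanSeries : ℤ⟦X⟧ := mk fun k => (catalan (2 * k + 1) : ℤ)

theorem coeff_mk_mul_mk (u v : ℕ → ℤ) (n : ℕ) :
    coeff n (mk u * mk v) = ∑ i ∈ Finset.range (n + 1), u i * v (n - i) := by
  rw [coeff_mul, Finset.Nat.sum_antidiagonal_eq_sum_range_succ_mk]
  simp

theorem evenCatalanSeries_eq :
    evenCatalanSeries = 1 + 2 * X * evenCatalanSeries * oddCatalanSeries := by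
  have h : (1 : ℤ⟦X⟧) + 2 * X * evenCatalanSeries * oddCatalanSeries =
      1 + X * (evenCatalanSeries * oddCatalanSeries + oddCatalanSeries * evenCatalanSeries) := by
    ring
  rw [h]
  ext n
  cases n with
  | zero => simp [evenCatalanSeries]
  | succ k =>
    rw [map_add, coeff_succ_X_mul, map_add, evenCatalanSeries, oddCatalanSeries,
      coeff_mk_mul_mk, coeff_mk_mul_mk, coeff_mk, ← Finset.sum_add_distrib,
      show 2 * (k + 1) = 2 * k + 1 + 1 by ring, catalan_succ_eq_sum_range,
      show 2 * k + 1 + 1 = 2 * (k + 1) by ring, sum_range_two_mul, coeff_one]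
    push_cast
    rw [zero_add]
    refine Finset.sum_congr rfl fun i hi => ?_
    have hi : i < k + 1 := Finset.mem_range.1 hi
    rw [show 2 * k + 1 - 2 * i = 2 * (k - i) + 1 by omega,
      Nat.mul_sub]

theorem oddCatalanSeries_eq :
    oddCatalanSeries = evenCatalanSeries ^ 2 + X * oddCatalanSeries ^ 2 := by
  rw [sq, sq]
  ext n
  rw [map_add, evenCatalanSeries, oddCatalanSeries, coeff_mk_mul_mk, coeff_mk,
    catalan_succ_eq_sum_range, Finset.sum_range_succ, sum_range_two_mul, Finset.sum_range_succ]
  cases n with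
  | zero => simp
  | succ k =>
    rw [coeff_succ_X_mul, coeff_mk_mul_mk]
    push_cast
    rw [Finset.sum_add_distrib, add_right_comm]
    congr 1
    · congr 1
      · refine Finset.sum_congr rfl fun i hi => ?_
        rw [Nat.mul_sub]
      · simp
    · refine Finset.sum_congr rfl fun i hi => ?_
      have hi : i < k + 1 := Finset.mem_range.1 hi
      rw [show 2 * (k + 1) - (2 * i + 1) = 2 * (k - i) + 1 by omega]

/-- Shapiro's convolution formula for the Catalan numbers of even index. -/
theorem evenCatalanSeries_sq :
    evenCatalanSeries ^ 2 = mk fun k => (4 ^ k * catalan k : ℤ) := by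
  set S : ℤ⟦X⟧ := mk fun k => (4 ^ k * catalan k : ℤ) with hSdef
  have hS : S = 1 + X * (4 * (S * S)) := by
    ext n
    cases n with
    | zero => simp [S]
    | succ k =>
      rw [map_add, coeff_succ_X_mul, show (4 : ℤ⟦X⟧) = C (4 : ℤ) by simp, coeff_C_mul, hSdef,
        coeff_mk_mul_mk, coeff_mk, catalan_succ_eq_sum_range, coeff_one]
      push_cast
      rw [zero_add]
      rw [pow_succ', mul_assoc, Finset.mul_sum]
      congr 1
      refine Finset.sum_congr rfl fun i hi => ?_
      have hi : i < k + 1 := Finset.mem_range.1 hi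
      rw [show (4 : ℤ) ^ k = 4 ^ i * 4 ^ (k - i) by rw [← pow_add]; congr 1; omega]
      ring
  have ha := evenCatalanSeries_eq
  have hb := oddCatalanSeries_eq
  set a := evenCatalanSeries
  set b := oddCatalanSeries
  have hT : a ^ 2 = 1 + X * (4 * (a ^ 2 * a ^ 2)) := by
    linear_combination (a + 1 + 2 * X * a * b - 4 * X * a * b) * ha + 4 * X * a ^ 2 * hb
  have hmul : (a ^ 2 - S) * (1 - X * (4 * (a ^ 2 + S))) = 0 := by
    linear_combination hT - hS
  refine sub_eq_zero.1 ((mul_eq_zero.1 hmul).resolve_right fun h => ?_)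
  simpa using congrArg constantCoeff h

/-- Sequences linked by the first-return recurrences with the Catalan numbers. -/
theorem eq_of_catalan_recurrences (e g : ℕ → ℤ)
    (he₀ : e 0 = 1)
    (he : ∀ n, e (n + 1) = catalan (2 * (n + 1)) +
      ∑ i ∈ Finset.range (n + 1), g i * catalan (2 * (n - i)))
    (hg₀ : g 0 = 1)
    (hg : ∀ n, g (n + 1) = catalan (2 * (n + 1) + 1) +
      ∑ i ∈ Finset.range (n + 1), g i * catalan (2 * (n - i) + 1)) (n : ℕ) :
    e n = 2 ^ (2 * n + 1) * catalan n - catalan (2 * n + 1) := by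
  have hE : mk e = evenCatalanSeries + X * (mk g * evenCatalanSeries) := by
    ext n
    cases n with
    | zero => simp [he₀, evenCatalanSeries]
    | succ n =>
      rw [map_add, coeff_succ_X_mul, evenCatalanSeries, coeff_mk_mul_mk, coeff_mk, coeff_mk, he]
  have hG : mk g = oddCatalanSeries + X * (mk g * oddCatalanSeries) := by
    ext n
    cases n with
    | zero => simp [hg₀, oddCatalanSeries]
    | succ n =>
      rw [map_add, coeff_succ_X_mul, oddCatalanSeries, coeff_mk_mul_mk, coeff_mk, coeff_mk, hg]
  have key : mk e = 2 * evenCatalanSeries ^ 2 - oddCatalanSeries := by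
    have ha := evenCatalanSeries_eq
    have hb := oddCatalanSeries_eq
    set a := evenCatalanSeries
    set b := oddCatalanSeries
    have hmul : (mk e - (2 * a ^ 2 - b)) * (1 - X * b) = 0 := by
      linear_combination (1 - X * b) * hE + X * a * hG - a * ha + hb
    refine sub_eq_zero.1 ((mul_eq_zero.1 hmul).resolve_right fun h => ?_)
    simpa using congrArg constantCoeff h
  have := congrArg (coeff n) key
  rw [evenCatalanSeries_sq, oddCatalanSeries, map_sub, coeff_mk, coeff_mk,
    show (2 : ℤ⟦X⟧) = C (2 : ℤ) by simp, coeff_C_mul, coeff_mk] at this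
  rw [this, pow_succ, pow_mul]
  norm_num
  ring

end CatalanSeries

/-- The ballot numbers -/
def ballot (a : ℕ) : ℕ → ℤ
  | 0 => 1
  | b + 1 => (a + b + 1).choose (b + 1) - (a + b + 1).choose b

theorem ballot_succ_succ (a b : ℕ) :
    ballot (a + 1) (b + 1) = ballot a (b + 1) + ballot (a + 1) b := by
  cases b with
  | zero => simp [ballot]
  | succ b =>
    simp only [ballot]
    rw [show a + 1 + (b + 1) + 1 = (a + b + 2) + 1 by ring, show a + (b + 1) + 1 = a + b + 2 by ring,
      show a + 1 + b + 1 = a + b + 2 by ring, Nat.choose_succ_succ (a + b + 2) (b + 1),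
      Nat.choose_succ_succ (a + b + 2) b]
    push_cast
    ring

theorem ballot_self_succ (a : ℕ) : ballot a (a + 1) = 0 := by
  rw [ballot, sub_eq_zero, Nat.choose_symm_of_eq_add (by ring)]

theorem ballot_self (a : ℕ) : ballot a a = catalan a := by
  cases a with
  | zero => simp [ballot]
  | succ b =>
    have h := congrArg (Nat.cast : ℕ → ℤ) (Nat.choose_succ_right_eq (2 * (b + 1)) b)
    have h2 := congrArg (Nat.cast : ℕ → ℤ) (succ_mul_catalan_eq_centralBinom (b + 1))
    rw [Nat.centralBinom] at h2
    rw [show 2 * (b + 1) - b = b + 2 by omega] at h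
    push_cast at h h2
    rw [ballot, show b + 1 + b + 1 = 2 * (b + 1) by ring]
    refine mul_left_cancel₀ (show (b + 2 : ℤ) ≠ 0 by positivity) ?_
    linear_combination h - h2

/-- The ballot numbers extended by zero to integer arguments. -/
def intBallot (a b : ℤ) : ℤ :=
  if a < 0 ∨ b < 0 then 0 else ballot a.toNat b.toNat

theorem intBallot_of_neg {a b : ℤ} (h : a < 0 ∨ b < 0) : intBallot a b = 0 := if_pos h

theorem intBallot_natCast (a b : ℕ) : intBallot a b = ballot a b := by
  rw [intBallot, if_neg (by omega)]
  simp

theorem intBallot_succ (a b : ℤ) (h : b ≤ a) :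
    intBallot a b = intBallot (a - 1) b + intBallot a (b - 1) +
      if a = 0 ∧ b = 0 then 1 else 0 := by
  rcases lt_or_ge b 0 with hb | hb
  · rw [intBallot_of_neg (.inr hb), intBallot_of_neg (.inr hb),
      intBallot_of_neg (.inr (by omega)), if_neg (by omega)]
    rfl
  · obtain ⟨a, rfl⟩ := Int.eq_ofNat_of_zero_le (hb.trans h)
    obtain ⟨b, rfl⟩ := Int.eq_ofNat_of_zero_le hb
    cases b with
    | zero =>
      rw [intBallot_of_neg (b := _ - 1) (.inr (by simp))]
      cases a with
      | zero => rw [intBallot_of_neg (a := _ - 1) (.inl (by simp)), intBallot_natCast]; rfl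
      | succ a =>
        rw [intBallot_natCast, Nat.cast_succ, add_sub_cancel_right, intBallot_natCast,
          if_neg (by omega)]
        rfl
    | succ b =>
      obtain ⟨a, rfl⟩ : ∃ c, a = c + 1 := ⟨a - 1, by omega⟩
      rw [if_neg (by omega), intBallot_natCast, ballot_succ_succ, Nat.cast_succ, Nat.cast_succ,
        add_sub_cancel_right, add_sub_cancel_right, ← Nat.cast_succ, ← Nat.cast_succ,
        intBallot_natCast, intBallot_natCast, add_zero]

theorem intBallot_self (a : ℕ) : intBallot a a = catalan a := by
  rw [intBallot_natCast, ballot_self]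

theorem intBallot_self_succ (a : ℤ) : intBallot a (a + 1) = 0 := by
  rcases lt_or_ge a 0 with ha | ha
  · exact intBallot_of_neg (.inl ha)
  · obtain ⟨a, rfl⟩ := Int.eq_ofNat_of_zero_le ha
    rw [← Nat.cast_succ, intBallot_natCast, ballot_self_succ]

/-- The U-steps of the path `P` stay weakly under the infinite boundary `U²R²U²R²⋯`. -/
def UnderDoubleStairs (P : List Bool) : Prop :=
  ∀ p r : List Bool, P = p ++ true :: r → 2 * (p.count true / 2) ≤ p.count false

theorem underDoubleStairs_nil : UnderDoubleStairs [] := by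
  intro p r h
  simp at h

theorem underDoubleStairs_append_false (P : List Bool) :
    UnderDoubleStairs (P ++ [false]) ↔ UnderDoubleStairs P := by
  constructor
  · rintro h p r rfl
    exact h p (r ++ [false]) (by simp)
  · intro h p r hP
    rcases List.eq_nil_or_concat r with rfl | ⟨r, b, rfl⟩
    · simp at hP
    · rw [List.concat_eq_append, ← List.cons_append, ← List.append_assoc] at hP
      exact h p r (List.append_inj' hP rfl).1

theorem underDoubleStairs_append_true (P : List Bool) :
    UnderDoubleStairs (P ++ [true]) ↔
      UnderDoubleStairs P ∧ 2 * (P.count true / 2) ≤ P.count false := by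
  constructor
  · intro h
    refine ⟨?_, h P [] rfl⟩
    rintro p r rfl
    exact h p (r ++ [true]) (by simp)
  · rintro ⟨h, hP'⟩ p r hP
    rcases List.eq_nil_or_concat r with rfl | ⟨r, b, rfl⟩
    · obtain rfl : P = p := by simpa using hP
      exact hP'
    · rw [List.concat_eq_append, ← List.cons_append, ← List.append_assoc] at hP
      exact h p r (List.append_inj' hP rfl).1

theorem bdryUURRn_succ (n : ℕ) :
    bdryUURRn (n + 1) = true :: true :: false :: false :: bdryUURRn n := by
  simp [bdryUURRn, List.replicate_succ]

theorem count_false_of_bdryUURRn_eq {n : ℕ} {p r : List Bool}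
    (h : bdryUURRn n = p ++ true :: r) : p.count false = 2 * (p.count true / 2) := by
  induction n generalizing p with
  | zero => simp [bdryUURRn] at h
  | succ n ih =>
    rw [bdryUURRn_succ] at h
    rcases p with _ | ⟨a, _ | ⟨b, _ | ⟨c, _ | ⟨d, p⟩⟩⟩⟩ <;> simp at h
    · rfl
    · obtain ⟨rfl, -⟩ := h
      rfl
    · obtain ⟨rfl, rfl, rfl, rfl, h⟩ := h
      have := ih h
      simp
      omega

theorem exists_bdryUURRn_eq {n k : ℕ} (hk : k < 2 * n) :
    ∃ p r : List Bool, bdryUURRn n = p ++ true :: r ∧ p.count true = k := by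
  induction n generalizing k with
  | zero => omega
  | succ n ih =>
    rw [bdryUURRn_succ]
    match k with
    | 0 => exact ⟨[], _, rfl, rfl⟩
    | 1 => exact ⟨[true], _, rfl, rfl⟩
    | k + 2 =>
      obtain ⟨p, r, h, hp⟩ := ih (k := k) (by omega)
      exact ⟨true :: true :: false :: false :: p, r, by simp [h], by simp [hp]⟩

theorem underWord_bdryUURRn_iff {n : ℕ} {P : List Bool} (hP : P.count true ≤ 2 * n) :
    UnderWord (bdryUURRn n) P ↔ UnderDoubleStairs P := by
  constructor
  · rintro h p r rfl
    obtain ⟨q, s, hB, hq⟩ := exists_bdryUURRn_eq (n := n) (k := p.count true) (by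
      simp at hP
      omega)
    have := h q s p r hB rfl hq.symm
    rwa [count_false_of_bdryUURRn_eq hB, hq] at this
  · intro h q s p r hB hP hpq
    rw [count_false_of_bdryUURRn_eq hB, ← hpq]
    exact h p r hP

/-- The paths with terminus `(x, y)` lying weakly under `U²R²U²R²⋯`. -/
def doubleStairsPaths (x y : ℕ) : Set (List Bool) :=
  {P | P.count false = x ∧ P.count true = y ∧ UnderDoubleStairs P}

theorem finite_doubleStairsPaths (x y : ℕ) : (doubleStairsPaths x y).Finite := by
  refine (List.finite_length_eq Bool (x + y)).subset ?_
  rintro P ⟨rfl, rfl, -⟩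
  exact (List.count_false_add_count_true P).symm

theorem append_false_mem {P : List Bool} {x y : ℕ} :
    P ++ [false] ∈ doubleStairsPaths (x + 1) y ↔ P ∈ doubleStairsPaths x y := by
  simp [doubleStairsPaths, underDoubleStairs_append_false]

theorem append_false_notMem {P : List Bool} {y : ℕ} :
    P ++ [false] ∉ doubleStairsPaths 0 y := by
  simp [doubleStairsPaths]

theorem append_true_mem {P : List Bool} {x y : ℕ} :
    P ++ [true] ∈ doubleStairsPaths x (y + 1) ↔
      P ∈ doubleStairsPaths x y ∧ 2 * (y / 2) ≤ x := by
  simp only [doubleStairsPaths, underDoubleStairs_append_true, Set.mem_ofPred_eq,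
    List.count_append]
  simp
  grind

theorem append_true_notMem {P : List Bool} {x : ℕ} :
    P ++ [true] ∉ doubleStairsPaths x 0 := by
  simp [doubleStairsPaths]

/-- The number of paths with terminus `(x, y)` lying weakly under `U²R²U²R²⋯`. -/
noncomputable def numDoubleStairsPaths (x y : ℕ) : ℤ := (doubleStairsPaths x y).ncard

theorem ncard_eq_add (S : Set (List Bool)) (hS : S.Finite) (h : [] ∉ S) :
    S.ncard = {P | P ++ [false] ∈ S}.ncard + {P | P ++ [true] ∈ S}.ncard := by
  have hinj (b : Bool) : Function.Injective fun P : List Bool => P ++ [b] :=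
    List.append_left_injective [b]
  have hcov : S = (fun P => P ++ [false]) '' {P | P ++ [false] ∈ S} ∪
      (fun P => P ++ [true]) '' {P | P ++ [true] ∈ S} := by
    ext P
    rcases List.eq_nil_or_concat P with rfl | ⟨P, b, rfl⟩
    · simp [h]
    · cases b <;> simp
  conv_lhs => rw [hcov]
  rw [Set.ncard_union_eq ?_ (hS.subset (Set.subset_union_left.trans hcov.superset))
    (hS.subset (Set.subset_union_right.trans hcov.superset)), Set.ncard_image_of_injective _ (hinj _),
    Set.ncard_image_of_injective _ (hinj _)]
  · rw [Set.disjoint_left]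
    rintro _ ⟨P, -, rfl⟩ ⟨Q, -, h⟩
    simpa using congrArg List.getLast? h

theorem nil_notMem {x y : ℕ} (h : x + y ≠ 0) : [] ∉ doubleStairsPaths x y := by
  rintro ⟨hx, hy, -⟩
  simp at hx hy
  omega

theorem numDoubleStairsPaths_zero_right (x : ℕ) : numDoubleStairsPaths x 0 = 1 := by
  induction x with
  | zero =>
    have : doubleStairsPaths 0 0 = {[]} := by
      ext P
      rcases List.eq_nil_or_concat P with rfl | ⟨P, b, rfl⟩
      · simp [doubleStairsPaths, underDoubleStairs_nil]
      · cases b <;> simp [doubleStairsPaths]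
    simp [numDoubleStairsPaths, this]
  | succ x ih =>
    rw [← ih, numDoubleStairsPaths, ncard_eq_add _ (finite_doubleStairsPaths _ _)
      (nil_notMem (by omega))]
    simp [append_false_mem, append_true_notMem, numDoubleStairsPaths]

theorem numDoubleStairsPaths_zero_succ (y : ℕ) :
    numDoubleStairsPaths 0 (y + 1) = if y < 2 then numDoubleStairsPaths 0 y else 0 := by
  rw [numDoubleStairsPaths, ncard_eq_add _ (finite_doubleStairsPaths _ _)
    (nil_notMem (by omega))]
  simp only [append_true_mem, append_false_notMem]
  split_ifs with h
  · simp [show 2 * (y / 2) ≤ 0 by omega, numDoubleStairsPaths]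
  · simp [show ¬ 2 * (y / 2) ≤ 0 by omega]

theorem numDoubleStairsPaths_succ_succ (x y : ℕ) :
    numDoubleStairsPaths (x + 1) (y + 1) = numDoubleStairsPaths x (y + 1) +
      if 2 * (y / 2) ≤ x + 1 then numDoubleStairsPaths (x + 1) y else 0 := by
  rw [numDoubleStairsPaths, ncard_eq_add _ (finite_doubleStairsPaths _ _)
    (nil_notMem (by omega))]
  simp only [append_true_mem, append_false_mem]
  split_ifs with h
  · simp [h, numDoubleStairsPaths]
  · simp [h, numDoubleStairsPaths]

theorem numDoubleStairsPaths_eq_zero {x y : ℕ} (h : x < 2 * (y / 2)) :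
    numDoubleStairsPaths x (y + 1) = 0 := by
  induction x with
  | zero => rw [numDoubleStairsPaths_zero_succ, if_neg (by omega)]
  | succ x ih =>
    rw [numDoubleStairsPaths_succ_succ, ih (by omega), if_neg (by omega), add_zero]

theorem numDoubleStairsPaths_diag (x : ℕ) :
    numDoubleStairsPaths x (x + 2) =
      if x % 2 = 0 then numDoubleStairsPaths x (x + 1) else 0 := by
  split_ifs with h
  · cases x with
    | zero => rw [numDoubleStairsPaths_zero_succ, if_pos (by omega)]
    | succ x =>
      rw [numDoubleStairsPaths_succ_succ, numDoubleStairsPaths_eq_zero (by omega),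
        if_pos (by omega), zero_add]
  · exact numDoubleStairsPaths_eq_zero (by omega)

theorem numDoubleStairsPaths_eq (M x y : ℕ) (hyx : y ≤ x + 1) (hyM : y ≤ 2 * M + 1) :
    numDoubleStairsPaths x y = intBallot (x + 1) y +
      ∑ i ∈ Finset.range M, numDoubleStairsPaths (2 * i) (2 * i + 1) *
        intBallot (x - (2 * i + 1)) (y - (2 * i + 2)) := by
  induction y generalizing x with
  | zero =>
    rw [numDoubleStairsPaths_zero_right, Finset.sum_eq_zero, ← Nat.cast_succ, intBallot_natCast]
    · rfl
    · intro i _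
      rw [intBallot_of_neg (.inr (by push_cast; omega)), mul_zero]
  | succ y ihy =>
    induction x with
    | zero =>
      obtain rfl : y = 0 := by omega
      rw [numDoubleStairsPaths_zero_succ, if_pos (by omega), numDoubleStairsPaths_zero_right,
        Finset.sum_eq_zero, ← Nat.cast_succ, intBallot_natCast]
      · rfl
      · intro i _
        rw [intBallot_of_neg (.inl (by push_cast; omega)), mul_zero]
    | succ x ihx =>
      have hstep (i : ℕ) : numDoubleStairsPaths (2 * i) (2 * i + 1) *
          intBallot ((x + 1 : ℕ) - (2 * i + 1)) ((y + 1 : ℕ) - (2 * i + 2)) =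
          numDoubleStairsPaths (2 * i) (2 * i + 1) *
            intBallot (x - (2 * i + 1)) ((y + 1 : ℕ) - (2 * i + 2)) +
          numDoubleStairsPaths (2 * i) (2 * i + 1) *
            intBallot ((x + 1 : ℕ) - (2 * i + 1)) (y - (2 * i + 2)) +
          if x = 2 * i ∧ y = 2 * i + 1 then numDoubleStairsPaths (2 * i) (2 * i + 1) else 0 := by
        rw [intBallot_succ _ _ (by push_cast; omega), mul_add, mul_add]
        congr 1
        · congr 3 <;> (push_cast; ring)
        · rw [mul_ite, mul_one, mul_zero]
          exact if_congr (by push_cast; omega) rfl rfl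
      rw [numDoubleStairsPaths_succ_succ, if_pos (by omega), ihy (x + 1) (by omega) (by omega),
        Finset.sum_congr rfl fun i _ => hstep i, Finset.sum_add_distrib, Finset.sum_add_distrib,
        intBallot_succ _ ((y + 1 : ℕ) : ℤ) (by push_cast; omega), if_neg (by push_cast; omega)]
      suffices h : numDoubleStairsPaths x (y + 1) = intBallot (x + 1) (y + 1 : ℕ) +
          ∑ i ∈ Finset.range M, numDoubleStairsPaths (2 * i) (2 * i + 1) *
            intBallot (x - (2 * i + 1)) ((y + 1 : ℕ) - (2 * i + 2)) +
          ∑ i ∈ Finset.range M, if x = 2 * i ∧ y = 2 * i + 1 then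
            numDoubleStairsPaths (2 * i) (2 * i + 1) else 0 by
        rw [h]
        push_cast
        rw [add_sub_cancel_right, add_sub_cancel_right]
        ring
      rcases Nat.lt_or_ge x y with hxy | hxy
      · obtain rfl : y = x + 1 := by omega
        rw [numDoubleStairsPaths_diag, Nat.cast_succ, Nat.cast_succ, intBallot_self_succ,
          Finset.sum_eq_zero fun i _ => ?_, zero_add, zero_add]
        · split_ifs with hx
          · rw [Finset.sum_eq_single (x / 2), if_pos (by omega), Nat.mul_div_cancel' (by omega)]
            · intro i _ hi
              rw [if_neg (by omega)]
            · simp only [Finset.mem_range]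
              omega
          · rw [Finset.sum_eq_zero]
            intro i _
            rw [if_neg (by omega)]
        · rw [show (x + 1 + 1 - (2 * i + 2) : ℤ) = x - (2 * i + 1) + 1 by ring,
            intBallot_self_succ, mul_zero]
      · rw [ihx (by omega), Finset.sum_eq_zero (s := Finset.range M)
          (f := fun i => if x = 2 * i ∧ y = 2 * i + 1 then _ else 0) fun i _ => ?_, add_zero]
        rw [if_neg (by omega)]

theorem numDoubleStairsPaths_even_diag (n : ℕ) :
    numDoubleStairsPaths (2 * n) (2 * n + 1) = catalan (2 * n + 1) +
      ∑ i ∈ Finset.range n, numDoubleStairsPaths (2 * i) (2 * i + 1) *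
        catalan (2 * (n - 1 - i) + 1) := by
  rw [numDoubleStairsPaths_eq n _ _ le_rfl le_rfl, ← Nat.cast_succ, intBallot_self]
  congr 1
  refine Finset.sum_congr rfl fun i hi => ?_
  have hi : i < n := Finset.mem_range.1 hi
  rw [← intBallot_self]
  congr 2 <;> omega

theorem numDoubleStairsPaths_odd_diag (n : ℕ) :
    numDoubleStairsPaths (2 * n + 1) (2 * n + 2) = catalan (2 * n + 2) +
      ∑ i ∈ Finset.range (n + 1), numDoubleStairsPaths (2 * i) (2 * i + 1) *
        catalan (2 * (n - i)) := by
  rw [numDoubleStairsPaths_eq (n + 1) _ _ le_rfl (by omega), ← Nat.cast_succ, intBallot_self]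
  congr 1
  refine Finset.sum_congr rfl fun i hi => ?_
  have hi : i < n + 1 := Finset.mem_range.1 hi
  rw [← intBallot_self]
  congr 2 <;> omega

theorem stmt15 (n : ℕ) (hn : 1 ≤ n) :
    ((Nat.card {P : List Bool //
        P.count false = 2 * n - 1 ∧ P.count true = 2 * n ∧
        UnderWord (bdryUURRn n) P} : ℕ) : ℤ) =
      2 ^ (2 * n + 1) * catalan n - catalan (2 * n + 1) := by
  obtain ⟨m, rfl⟩ : ∃ m, n = m + 1 := ⟨n - 1, by omega⟩
  have hset : {P : List Bool | P.count false = 2 * (m + 1) - 1 ∧ P.count true = 2 * (m + 1) ∧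
      UnderWord (bdryUURRn (m + 1)) P} = doubleStairsPaths (2 * m + 1) (2 * m + 2) := by
    ext P
    exact and_congr Iff.rfl (and_congr_right fun h => underWord_bdryUURRn_iff h.le)
  have hcard : ((Nat.card {P : List Bool // P.count false = 2 * (m + 1) - 1 ∧
      P.count true = 2 * (m + 1) ∧ UnderWord (bdryUURRn (m + 1)) P} : ℕ) : ℤ) =
      numDoubleStairsPaths (2 * m + 1) (2 * m + 2) := by
    rw [numDoubleStairsPaths, ← hset]
    rfl
  rw [hcard]
  refine eq_of_catalan_recurrences
    (fun k => k.casesOn 1 fun k => numDoubleStairsPaths (2 * k + 1) (2 * k + 2))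
    (fun k => numDoubleStairsPaths (2 * k) (2 * k + 1)) rfl numDoubleStairsPaths_odd_diag
    ?_ (fun k => ?_) (m + 1)
  · simpa using numDoubleStairsPaths_even_diag 0
  · exact numDoubleStairsPaths_even_diag (k + 1)
end
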